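/- arXiv:0711.3728 — 6 statements merged into one kernel-verified Lean document; each statement's English description precedes it below -/
import Mathlib

section
/- Let ℓ ≥ 1 be an integer and let x = (x_1, …, x_{ℓ+1}) ∈ (ℚ^{ℓ+1})^0_+. Then there exists an integer i with 1 ≤ i ≤ ℓ such that x_{ℓ−i+2} + x_{ℓ−i+3} + ⋯ + x_{ℓ+1} > x_{ℓ−i+2} − x_{ℓ−i+1} if and only if x_2 < 0 or x_ℓ > 0. (This is the combinatorial characterization, for G = PGL_{ℓ+1}, of when the complement of the period domain in the flag variety has a codimension-one component: the left-hand side is the inequality (ω_i, s_{α_i} w_0 ν) > 0 for the co-fundamental weight ω_i, simple root α_i and longest Weyl element w_0 of type A_ℓ.) -/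
/-- For `x ∈ (ℚ^{ℓ+1})^0_+` with `ℓ ≥ 1`, there is `1 ≤ i ≤ ℓ` with
`x_{ℓ-i+2} + ⋯ + x_{ℓ+1} > x_{ℓ-i+2} - x_{ℓ-i+1}` (1-based) iff `x_2 < 0` or `x_ℓ > 0`.
In 0-based indexing the sum runs over positions `ℓ-i+1, …, ℓ`. -/
theorem stmt1 (ℓ : ℕ) (hl : 1 ≤ ℓ) (x : Fin (ℓ + 1) → ℚ)
    (hmono : ∀ i j : Fin (ℓ + 1), i ≤ j → x j ≤ x i)
    (hsum : ∑ i, x i = 0) :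
    (∃ (i : ℕ) (h1 : 1 ≤ i) (h2 : i ≤ ℓ),
        (∑ j ∈ Finset.univ.filter (fun j : Fin (ℓ + 1) => ℓ - i + 1 ≤ (j : ℕ)), x j) >
          x ⟨ℓ - i + 1, by omega⟩ - x ⟨ℓ - i, by omega⟩) ↔
      (x ⟨1, by omega⟩ < 0 ∨ x ⟨ℓ - 1, by omega⟩ > 0) := by
  have hsplit (k : ℕ) :
      ∑ j ∈ Finset.univ.filter (fun j : Fin (ℓ + 1) => ¬ k + 1 ≤ (j : ℕ)), x j =
        -∑ j ∈ Finset.univ.filter (fun j : Fin (ℓ + 1) => k + 1 ≤ (j : ℕ)), x j := by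
    have := Finset.sum_filter_add_sum_filter_not Finset.univ
      (fun j : Fin (ℓ + 1) => k + 1 ≤ (j : ℕ)) x
    linarith
  constructor
  · rintro ⟨i, h1, h2, h⟩
    by_contra! hcon
    obtain ⟨hx1, hxl⟩ := hcon
    suffices key : ∀ (k : ℕ) (hk : k + 1 ≤ ℓ),
        ∑ j ∈ Finset.univ.filter (fun j : Fin (ℓ + 1) => k + 1 ≤ (j : ℕ)), x j ≤
          x ⟨k + 1, by omega⟩ - x ⟨k, by omega⟩ from
      absurd h (not_lt.mpr (key (ℓ - i) (by omega)))
    intro k hk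
    have hL := hsplit k
    have head_nonneg (h0 : 0 ≤ x ⟨k, by omega⟩) :
        ∀ j ∈ Finset.univ.filter (fun j : Fin (ℓ + 1) => ¬ k + 1 ≤ (j : ℕ)), 0 ≤ x j := by
      intro j hj
      refine h0.trans (hmono _ _ ?_)
      simp only [Finset.mem_filter] at hj
      rw [Fin.le_def]
      dsimp only
      omega
    have tail_nonneg (h0 : x ⟨k + 1, by omega⟩ ≤ 0) :
        ∀ j ∈ Finset.univ.filter (fun j : Fin (ℓ + 1) => k + 1 ≤ (j : ℕ)), 0 ≤ -x j := by
      intro j hj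
      refine neg_nonneg.mpr ((hmono _ _ ?_).trans h0)
      simp only [Finset.mem_filter] at hj
      exact hj.2
    have hkk : x ⟨k + 1, by omega⟩ ≤ x ⟨k, by omega⟩ := hmono _ _ (by simp [Fin.le_def])
    rcases le_total 0 (x ⟨k + 1, by omega⟩) with hpos | hneg
    · have := Finset.single_le_sum (head_nonneg (hpos.trans hkk))
        (show (⟨k, by omega⟩ : Fin (ℓ + 1)) ∈ _ by simp)
      linarith
    rcases le_total (x ⟨k, by omega⟩) 0 with hneg' | hpos'
    · have := Finset.single_le_sum (tail_nonneg hneg)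
        (show (⟨k + 1, by omega⟩ : Fin (ℓ + 1)) ∈ _ by simp)
      rw [Finset.sum_neg_distrib] at this
      linarith
    rcases Nat.eq_zero_or_pos k with rfl | hk0
    · have := Finset.single_le_sum (head_nonneg hpos')
        (show (⟨0, by omega⟩ : Fin (ℓ + 1)) ∈ _ by simp)
      simp only [zero_add] at *
      linarith
    rcases Nat.lt_or_ge (k + 1) ℓ with hkl | hkl
    · have hhead := Finset.add_le_sum (head_nonneg hpos')
        (show (⟨k, by omega⟩ : Fin (ℓ + 1)) ∈ _ by simp)
        (show (⟨k - 1, by omega⟩ : Fin (ℓ + 1)) ∈ _ by simp)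
        (by simp; omega)
      have htail := Finset.add_le_sum (tail_nonneg hneg)
        (show (⟨k + 1, by omega⟩ : Fin (ℓ + 1)) ∈ _ by simp)
        (show (⟨k + 2, by omega⟩ : Fin (ℓ + 1)) ∈ _ by simp)
        (by simp)
      rw [Finset.sum_neg_distrib] at htail
      have hpred : x ⟨k, by omega⟩ ≤ x ⟨k - 1, by omega⟩ := hmono _ _ (by simp [Fin.le_def])
      have hsucc : x ⟨k + 2, by omega⟩ ≤ x ⟨k + 1, by omega⟩ := hmono _ _ (by simp [Fin.le_def])
      linarith
    · obtain rfl : ℓ = k + 1 := by omega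
      simp only [Nat.add_sub_cancel] at hxl
      have := Finset.single_le_sum (tail_nonneg hneg)
        (show (⟨k + 1, by omega⟩ : Fin (k + 1 + 1)) ∈ _ by simp)
      rw [Finset.sum_neg_distrib] at this
      linarith
  · rintro (h | h)
    · refine ⟨ℓ, hl, le_rfl, ?_⟩
      have hL := hsplit 0
      have : Finset.univ.filter (fun j : Fin (ℓ + 1) => ¬ 0 + 1 ≤ (j : ℕ)) = {0} := by
        ext j
        simp only [Finset.mem_filter, Finset.mem_univ, true_and, Finset.mem_singleton,
          Fin.ext_iff, Fin.val_zero]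
        omega
      rw [this, Finset.sum_singleton] at hL
      have h0 : x ⟨0, by omega⟩ = x 0 := rfl
      simp only [Nat.sub_self, zero_add] at hL ⊢
      linarith
    · refine ⟨1, le_rfl, hl, ?_⟩
      have : Finset.univ.filter (fun j : Fin (ℓ + 1) => ℓ - 1 + 1 ≤ (j : ℕ)) =
          {⟨ℓ - 1 + 1, by omega⟩} := by
        ext j
        simp only [Finset.mem_filter, Finset.mem_univ, true_and, Finset.mem_singleton,
          Fin.ext_iff]
        omega
      rw [this, Finset.sum_singleton]
      linarith
end

section
/- Let E be a real inner product space, m a natural number, and ω, α : {1,…,m} → E two families of vectors such that: ⟨ω_a, ω_b⟩ ≥ 0 for all a, b; ⟨ω_a, α_b⟩ = 0 for a ≠ b; ⟨ω_a, α_a⟩ = ⟨α_a, α_a⟩/2 for all a; and ⟨ω_a, ω_a⟩ ≥ ⟨α_a, α_a⟩/2 for all a. Let n : {1,…,m} → ℝ with n_j ≥ 0 for all j, let τ be a permutation of {1,…,m}, and set z = −Σ_{j=1}^m n_j ω_{τ(j)}. Then for every i, ⟨ω_i, z⟩ ≤ ⟨α_i, z⟩. (This is the key inequality showing that for split root systems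 other than type A_ℓ the complement of the period domain has codimension at least 2: here α_j are the simple roots, ω_j the co-fundamental weights satisfying (ω_a, α_b^∨) = δ_{ab}, and z = w_0ν for a dominant ν = Σ n_j ω_j.) -/
open RealInnerProductSpace

/-- With `ω` the co-fundamental weights and `α` the simple roots
(`⟪ω a, ω b⟫ ≥ 0`, `⟪ω a, α b⟫ = 0` for `a ≠ b`, `⟪ω a, α a⟫ = ⟪α a, α a⟫/2`,
`⟪ω a, ω a⟫ ≥ ⟪α a, α a⟫/2`), `n j ≥ 0`, `τ` a permutation, and
`z = -∑ j n j • ω (τ j)`, one has `⟪ω i, z⟫ ≤ ⟪α i, z⟫` for every `i`. -/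
theorem stmt3 {E : Type*} [NormedAddCommGroup E] [InnerProductSpace ℝ E]
    (m : ℕ) (ω α : Fin m → E)
    (hωω : ∀ a b : Fin m, 0 ≤ ⟪ω a, ω b⟫)
    (hωα : ∀ a b : Fin m, a ≠ b → ⟪ω a, α b⟫ = 0)
    (hdual : ∀ a : Fin m, ⟪ω a, α a⟫ = ⟪α a, α a⟫ / 2)
    (hlen : ∀ a : Fin m, ⟪α a, α a⟫ / 2 ≤ ⟪ω a, ω a⟫)
    (n : Fin m → ℝ) (hn : ∀ j, 0 ≤ n j) (τ : Equiv.Perm (Fin m)) (i : Fin m) :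
    ⟪ω i, -∑ j, n j • ω (τ j)⟫ ≤ ⟪α i, -∑ j, n j • ω (τ j)⟫ := by
  rw [inner_neg_right, inner_neg_right, neg_le_neg_iff, inner_sum, inner_sum]
  refine Finset.sum_le_sum fun j _ => ?_
  rw [real_inner_smul_right, real_inner_smul_right]
  refine mul_le_mul_of_nonneg_left ?_ (hn j)
  rw [real_inner_comm]
  by_cases h : τ j = i
  · rw [h, hdual]
    exact hlen i
  · rw [hωα _ _ h]
    exact hωω _ _
end

section
/- Let ℓ ≥ 2 and let x = (x_1, …, x_{ℓ+1}) ∈ (ℚ^{ℓ+1})^0_+. In ℚ^{ℓ+1} with the standard dot product, let β_j = e_j − e_{j+1} for 1 ≤ j ≤ ℓ (the simple roots of type A_ℓ), and let ω_{β_j} = (1/(ℓ+1))·((ℓ+1−j), …, (ℓ+1−j), −j, …, −j), with ℓ+1−j appearing j times and −j appearing ℓ+1−j times (the co-fundamental weights). Let d = ⌊(ℓ+1)/2⌋, and for 1 ≤ i ≤ d set ω_i = ω_{β_i} + ω_{β_{ℓ+1−i}} if i ≠ ℓ+1−i, and ω_i = ω_{β_i} if 2i = ℓ+1 (the relative co-fundamental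 weights of the projective unitary group PU_{ℓ+1}). Let w_0x = (x_{ℓ+1}, x_ℓ, …, x_1) be the reversal of x. Then for every i with 1 ≤ i ≤ d and every β ∈ {β_i, β_{ℓ+1−i}}, one has ⟨ω_i, w_0x⟩ ≤ ⟨β, w_0x⟩. (This shows that for the quasi-split non-split group PU_{ℓ+1} the inequality (ω_i, s_β w_0ν) > 0 never holds, so the complement of the period domain always has codimension at least 2.) -/
open Matrix

open Finset in
/-- For a sequence `y`, monotone on `[0, n)` with zero sum, the partial sums of lengths `i` and
`n - i` add up to at most `i` times the gap between `y (i - 1)` and `y (n - i)`. -/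
lemma sum_range_add_sum_range_sub_le {n i : ℕ} (y : ℕ → ℚ)
    (hy : ∀ a b, a ≤ b → b < n → y a ≤ y b) (hsum : ∑ k ∈ range n, y k = 0)
    (hi : 1 ≤ i) (hin : 2 * i ≤ n) :
    ∑ k ∈ range i, y k + ∑ k ∈ range (n - i), y k ≤ i * (y (i - 1) - y (n - i)) := by
  have hsplit := sum_range_add y (n - i) i
  rw [Nat.sub_add_cancel (by omega), hsum] at hsplit
  have hle : ∑ k ∈ range i, (y k - y (n - i + k)) ≤
      ∑ _k ∈ range i, (y (i - 1) - y (n - i)) := by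
    refine sum_le_sum fun k hk => ?_
    rw [mem_range] at hk
    have h₁ := hy k (i - 1) (by omega) (by omega)
    have h₂ := hy (n - i) (n - i + k) (by omega) (by omega)
    linarith
  rw [sum_sub_distrib, sum_const, card_range, nsmul_eq_mul] at hle
  linarith

open Finset in
/-- On vectors of zero sum, pairing with the `j`-th co-fundamental weight is the partial sum of
the first `j` coordinates. -/
lemma cofundamentalWeight_dotProduct {ℓ j : ℕ} (hj : j ≤ ℓ + 1) (y : ℕ → ℚ)
    (hsum : ∑ k ∈ range (ℓ + 1), y k = 0) :
    (fun i : Fin (ℓ + 1) => if (i : ℕ) + 1 ≤ j then ((ℓ : ℚ) + 1 - (j : ℚ)) / ((ℓ : ℚ) + 1)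
      else -(j : ℚ) / ((ℓ : ℚ) + 1)) ⬝ᵥ (fun i : Fin (ℓ + 1) => y i) =
      ∑ k ∈ range j, y k := by
  have hpos : (ℓ : ℚ) + 1 ≠ 0 := by positivity
  rw [dotProduct, Fin.sum_univ_eq_sum_range (fun k => (if k + 1 ≤ j then
    ((ℓ : ℚ) + 1 - (j : ℚ)) / ((ℓ : ℚ) + 1) else -(j : ℚ) / ((ℓ : ℚ) + 1)) * y k)]
  have hterm : ∀ k, (if k + 1 ≤ j then ((ℓ : ℚ) + 1 - (j : ℚ)) / ((ℓ : ℚ) + 1)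
      else -(j : ℚ) / ((ℓ : ℚ) + 1)) * y k =
      (if k < j then y k else 0) + -(j : ℚ) / ((ℓ : ℚ) + 1) * y k := by
    intro k
    simp only [Nat.succ_le_iff]
    split_ifs
    · field_simp
      ring
    · ring
  rw [sum_congr rfl fun k _ => hterm k, sum_add_distrib, ← mul_sum, hsum, mul_zero, add_zero,
    ← sum_filter]
  congr 1
  ext k
  simp only [mem_filter, mem_range]
  omega

open Finset in
lemma simpleRoot_dotProduct {ℓ j : ℕ} (hj : 1 ≤ j) (hjl : j ≤ ℓ) (y : ℕ → ℚ) :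
    (fun i : Fin (ℓ + 1) => if (i : ℕ) + 1 = j then (1 : ℚ)
      else if (i : ℕ) + 1 = j + 1 then -1 else 0) ⬝ᵥ (fun i : Fin (ℓ + 1) => y i) =
      y (j - 1) - y j := by
  rw [dotProduct, Fin.sum_univ_eq_sum_range (fun k => (if k + 1 = j then (1 : ℚ)
    else if k + 1 = j + 1 then -1 else 0) * y k)]
  have hterm : ∀ k, (if k + 1 = j then (1 : ℚ) else if k + 1 = j + 1 then -1 else 0) * y k =
      (if k = j - 1 then y k else 0) - (if k = j then y k else 0) := by
    intro k
    split_ifs <;> first | omega | ring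
  rw [sum_congr rfl fun k _ => hterm k, sum_sub_distrib, sum_ite_eq', sum_ite_eq',
    if_pos (mem_range.2 (by omega)), if_pos (mem_range.2 (by omega))]

/-- Type `A_ℓ` data for the projective unitary group `PU_{ℓ+1}` (`ℓ ≥ 2`):
simple roots `β j = e_j - e_{j+1}` (1-based `j`), co-fundamental weights
`ω_{β_j} = ((ℓ+1-j)/(ℓ+1), …, -j/(ℓ+1), …)`, `d = ⌊(ℓ+1)/2⌋`, relative co-fundamental
weights `ω i = ω_{β_i} + ω_{β_{ℓ+1-i}}` (resp. `ω_{β_i}` if `2i = ℓ+1`), and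
`w₀x` the reversal of `x ∈ (ℚ^{ℓ+1})^0_+`. Then for every `1 ≤ i ≤ d` and every
`b ∈ {β i, β (ℓ+1-i)}` one has `⟨ω i, w₀x⟩ ≤ ⟨b, w₀x⟩`. -/
theorem stmt5 (ℓ : ℕ) (hl : 2 ≤ ℓ) (x : Fin (ℓ + 1) → ℚ)
    (hmono : ∀ i j : Fin (ℓ + 1), i ≤ j → x j ≤ x i)
    (hsum : ∑ i, x i = 0) :
    let β : ℕ → Fin (ℓ + 1) → ℚ := fun j i =>
      if (i : ℕ) + 1 = j then 1 else if (i : ℕ) + 1 = j + 1 then -1 else 0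
    let ωβ : ℕ → Fin (ℓ + 1) → ℚ := fun j i =>
      if (i : ℕ) + 1 ≤ j then ((ℓ : ℚ) + 1 - (j : ℚ)) / ((ℓ : ℚ) + 1)
      else -(j : ℚ) / ((ℓ : ℚ) + 1)
    let d : ℕ := (ℓ + 1) / 2
    let ω : ℕ → Fin (ℓ + 1) → ℚ := fun i =>
      if 2 * i = ℓ + 1 then ωβ i else ωβ i + ωβ (ℓ + 1 - i)
    let w₀x : Fin (ℓ + 1) → ℚ := fun i => x i.rev
    ∀ i : ℕ, 1 ≤ i → i ≤ d →
      ∀ b ∈ ({β i, β (ℓ + 1 - i)} : Set (Fin (ℓ + 1) → ℚ)),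
        ω i ⬝ᵥ w₀x ≤ b ⬝ᵥ w₀x := by
  intro β ωβ d ω w₀x i hi hid b hb
  have hin : 2 * i ≤ ℓ + 1 := by omega
  let y : ℕ → ℚ := fun k => x (Fin.ofNat (ℓ + 1) k).rev
  have hw : w₀x = fun k : Fin (ℓ + 1) => y k := by
    funext k
    simp [w₀x, y]
  have hy : ∀ a b, a ≤ b → b < ℓ + 1 → y a ≤ y b := by
    intro a b hab hb
    refine hmono _ _ (Fin.rev_le_rev.2 ?_)
    rw [Fin.le_def, Fin.val_ofNat, Fin.val_ofNat, Nat.mod_eq_of_lt hb,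
      Nat.mod_eq_of_lt (hab.trans_lt hb)]
    exact hab
  have hysum : ∑ k ∈ Finset.range (ℓ + 1), y k = 0 := by
    rw [← Fin.sum_univ_eq_sum_range, ← hsum, ← Equiv.sum_comp Fin.revPerm x]
    exact Finset.sum_congr rfl fun k _ => (congrFun hw k).symm
  have hωβ : ∀ j ≤ ℓ + 1, ωβ j ⬝ᵥ w₀x = ∑ k ∈ Finset.range j, y k := fun j hj => by
    rw [hw]
    exact cofundamentalWeight_dotProduct hj y hysum
  have hβ : ∀ j, 1 ≤ j → j ≤ ℓ → β j ⬝ᵥ w₀x = y (j - 1) - y j := fun j hj hjl => by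
    rw [hw]
    exact simpleRoot_dotProduct hj hjl y
  have hgap : y (i - 1) - y (ℓ + 1 - i) ≤ b ⬝ᵥ w₀x := by
    rcases hb with rfl | rfl
    · rw [hβ i hi (by omega)]
      linarith [hy i (ℓ + 1 - i) (by omega) (by omega)]
    · rw [hβ (ℓ + 1 - i) (by omega) (by omega)]
      linarith [hy (i - 1) (ℓ + 1 - i - 1) (by omega) (by omega)]
  have hgap_nonpos := hy (i - 1) (ℓ + 1 - i) (by omega) (by omega)
  have hmain := sum_range_add_sum_range_sub_le y hy hysum hi hin
  refine le_trans ?_ hgap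
  by_cases h : 2 * i = ℓ + 1
  · have hi2 : (2 : ℚ) ≤ i := by exact_mod_cast (by omega : 2 ≤ i)
    have hω : ω i = ωβ i := if_pos h
    have hsub : ℓ + 1 - i = i := by omega
    rw [hω, hωβ i (by omega)]
    rw [hsub] at hmain hgap_nonpos ⊢
    nlinarith
  · have hi1 : (1 : ℚ) ≤ i := by exact_mod_cast hi
    have hω : ω i = ωβ i + ωβ (ℓ + 1 - i) := if_neg h
    rw [hω, add_dotProduct, hωβ i (by omega), hωβ (ℓ + 1 - i) (by omega)]
    nlinarith
end

section
/- Assume the flag setup with m_1 = 1 and y_2 < 0 (so all weights y_2, …, y_r are negative). Then a flag F of type (y, m) is semistable if and only if F_1 (a line in k̄ ⊗_k V) is not contained in k̄ ⊗_k H for any k-rational hyperplane H ⊆ V, i.e., for any k-subspace H of V with dim_k H = n − 1. -/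
/-- The `k`-linear inclusion of `k`-rational vectors into `Fin n → K`. -/
noncomputable def ratInclusion (k K : Type*) [Field k] [Field K] [Algebra k K] (n : ℕ) :
    (Fin n → k) →ₗ[k] (Fin n → K) where
  toFun v := fun i => algebraMap k K (v i)
  map_add' v w := by ext i; simp
  map_smul' c v := by ext i; simp [Algebra.smul_def]

/-- Base change of a `k`-subspace `U ⊆ k^n` to a `K`-subspace of `K^n`. -/
noncomputable def baseChange (k K : Type*) [Field k] [Field K] [Algebra k K] (n : ℕ)
    (U : Submodule k (Fin n → k)) : Submodule K (Fin n → K) :=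
  Submodule.span K (ratInclusion k K n '' (U : Set (Fin n → k)))

/-- The predecessor `F_{i-1}` of the flag step `F_i`, with `F_0 = 0` (0-based indexing). -/
noncomputable def flagPrev {K : Type*} [Field K] {n r : ℕ}
    (F : Fin r → Submodule K (Fin n → K)) (i : Fin r) : Submodule K (Fin n → K) :=
  if _h : (i : ℕ) = 0 then ⊥
  else F ⟨(i : ℕ) - 1, lt_of_le_of_lt (Nat.sub_le _ _) i.isLt⟩

/-- The degree `deg_F(U) = ∑ᵢ yᵢ (dim(Fᵢ ∩ k̄⊗U) - dim(Fᵢ₋₁ ∩ k̄⊗U))` of a `k`-rational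
subspace `U` with respect to the flag `F` with weights `y`. -/
noncomputable def degFlag (k K : Type*) [Field k] [Field K] [Algebra k K] (n r : ℕ)
    (y : Fin r → ℚ) (F : Fin r → Submodule K (Fin n → K))
    (U : Submodule k (Fin n → k)) : ℚ :=
  ∑ i : Fin r, y i *
    ((Module.finrank K ↥(F i ⊓ baseChange k K n U) : ℚ) -
      (Module.finrank K ↥(flagPrev F i ⊓ baseChange k K n U) : ℚ))

/-- A flag is semistable if `deg_F(U) ≤ 0` for every nonzero `k`-rational subspace. -/
def IsSemistableFlag (k K : Type*) [Field k] [Field K] [Algebra k K] (n r : ℕ)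
    (y : Fin r → ℚ) (F : Fin r → Submodule K (Fin n → K)) : Prop :=
  ∀ U : Submodule k (Fin n → k), U ≠ ⊥ → degFlag k K n r y F U ≤ 0

section Flag

variable {k K : Type*} [Field k] [Field K] [Algebra k K] {n r : ℕ}

lemma baseChange_mono {U W : Submodule k (Fin n → k)} (h : U ≤ W) :
    baseChange k K n U ≤ baseChange k K n W :=
  Submodule.span_mono (Set.image_mono h)

lemma baseChange_top : baseChange k K n ⊤ = ⊤ := by
  rw [eq_top_iff, ← (Pi.basisFun K (Fin n)).span_eq, Submodule.span_le]
  rintro _ ⟨i, rfl⟩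
  refine Submodule.subset_span ⟨Pi.single i 1, trivial, ?_⟩
  ext j
  by_cases h : j = i
  · subst h
    simp [ratInclusion]
  · simp [ratInclusion, h]

lemma finrank_baseChange_le (U : Submodule k (Fin n → k)) :
    Module.finrank K (baseChange k K n U) ≤ Module.finrank k U := by
  let b := Module.finBasis k U
  have hspan : baseChange k K n U ≤
      Submodule.span K (Set.range fun i => ratInclusion k K n (b i)) := by
    refine Submodule.span_le.2 ?_
    rintro _ ⟨u, hu, rfl⟩
    have hrepr : u = ∑ i, b.repr ⟨u, hu⟩ i • (b i : Fin n → k) := by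
      have h := congrArg U.subtype (b.sum_repr ⟨u, hu⟩)
      rw [map_sum] at h
      exact h.symm
    rw [hrepr, map_sum]
    refine Submodule.sum_mem _ fun i _ => ?_
    rw [map_smul, ← algebraMap_smul K]
    exact Submodule.smul_mem _ _ (Submodule.subset_span ⟨i, rfl⟩)
  refine (Submodule.finrank_mono hspan).trans ?_
  exact (finrank_range_le_card (R := K) fun i => ratInclusion k K n (b i)).trans_eq
    (Fintype.card_fin _)

lemma exists_le_finrank_eq_of_ne_top {U : Submodule k (Fin n → k)} (hU : U ≠ ⊤) :
    ∃ H : Submodule k (Fin n → k), U ≤ H ∧ Module.finrank k H = n - 1 := by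
  obtain ⟨H, hH, hUH⟩ := (eq_top_or_exists_le_coatom U).resolve_left hU
  refine ⟨H, hUH, ?_⟩
  have : IsSimpleModule k ((Fin n → k) ⧸ H) := isSimpleModule_iff_isCoatom.2 hH
  have hone := isSimpleModule_iff_finrank_eq_one.1 this
  have hadd := H.finrank_quotient_add_finrank
  rw [hone, Module.finrank_fin_fun] at hadd
  omega

/-- The dimension of the `i`-th graded piece of the filtration induced by a flag on `W`. -/
noncomputable def gradedDim (F : Fin r → Submodule K (Fin n → K))
    (W : Submodule K (Fin n → K)) (i : Fin r) : ℚ :=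
  (Module.finrank K ↥(F i ⊓ W) : ℚ) - (Module.finrank K ↥(flagPrev F i ⊓ W) : ℚ)

lemma flagPrev_of_eq_zero (F : Fin r → Submodule K (Fin n → K)) {i : Fin r}
    (hi : (i : ℕ) = 0) : flagPrev F i = ⊥ :=
  dif_pos hi

lemma flagPrev_of_ne_zero (F : Fin r → Submodule K (Fin n → K)) {i : Fin r}
    (hi : (i : ℕ) ≠ 0) : flagPrev F i = F ⟨(i : ℕ) - 1, by omega⟩ :=
  dif_neg hi

lemma gradedDim_top (F : Fin r → Submodule K (Fin n → K)) (i : Fin r) :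
    gradedDim F ⊤ i = (Module.finrank K (F i) : ℚ) - Module.finrank K (flagPrev F i) := by
  rw [gradedDim, inf_top_eq, inf_top_eq]

lemma flagPrev_le {F : Fin r → Submodule K (Fin n → K)} (hF : Monotone F) (i : Fin r) :
    flagPrev F i ≤ F i := by
  unfold flagPrev
  split_ifs
  · exact bot_le
  · exact hF (Fin.le_def.2 (Nat.sub_le _ _))

lemma gradedDim_nonneg {F : Fin r → Submodule K (Fin n → K)} (hF : Monotone F)
    (W : Submodule K (Fin n → K)) (i : Fin r) : 0 ≤ gradedDim F W i :=
  sub_nonneg.2 (Nat.cast_le.2 (Submodule.finrank_mono (inf_le_inf_right W (flagPrev_le hF i))))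

lemma gradedDim_le_gradedDim_top {F : Fin r → Submodule K (Fin n → K)} (hF : Monotone F)
    (W : Submodule K (Fin n → K)) (i : Fin r) : gradedDim F W i ≤ gradedDim F ⊤ i := by
  have hPF := flagPrev_le hF i
  have hdim := Submodule.finrank_sup_add_finrank_inf_eq (F i ⊓ W) (flagPrev F i)
  have hinf : F i ⊓ W ⊓ flagPrev F i = flagPrev F i ⊓ W := by
    rw [inf_right_comm, inf_eq_right.2 hPF]
  have hsup : Module.finrank K ↥(F i ⊓ W ⊔ flagPrev F i) ≤ Module.finrank K (F i) :=
    Submodule.finrank_mono (sup_le inf_le_left hPF)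
  rw [hinf] at hdim
  rw [gradedDim_top, gradedDim]
  have hle : Module.finrank K ↥(F i ⊓ W) + Module.finrank K (flagPrev F i) ≤
      Module.finrank K (F i) + Module.finrank K ↥(flagPrev F i ⊓ W) := by omega
  have hle' : (Module.finrank K ↥(F i ⊓ W) : ℚ) + Module.finrank K (flagPrev F i) ≤
      Module.finrank K (F i) + Module.finrank K ↥(flagPrev F i ⊓ W) := by exact_mod_cast hle
  linarith

lemma gradedDim_zero (F : Fin r → Submodule K (Fin n → K)) (W : Submodule K (Fin n → K))
    (hr : 0 < r) : gradedDim F W ⟨0, hr⟩ = Module.finrank K ↥(F ⟨0, hr⟩ ⊓ W) := by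
  rw [gradedDim, flagPrev_of_eq_zero F rfl, bot_inf_eq, finrank_bot, Nat.cast_zero, sub_zero]

lemma gradedDim_top_eq {F : Fin r → Submodule K (Fin n → K)} {m : Fin r → ℕ}
    (hdim : ∀ i : Fin r,
      Module.finrank K ↥(F i) = ∑ j ∈ Finset.univ.filter (· ≤ i), m j) (i : Fin r) :
    gradedDim F ⊤ i = m i := by
  have hprev : Module.finrank K (flagPrev F i) =
      ∑ j ∈ Finset.univ.filter (· < i), m j := by
    by_cases h : (i : ℕ) = 0
    · rw [flagPrev_of_eq_zero F h, finrank_bot, Finset.filter_false_of_mem, Finset.sum_empty]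
      intro j _ hj
      have := Fin.lt_def.1 hj
      omega
    · rw [flagPrev_of_ne_zero F h, hdim]
      congr 1
      ext j
      simp only [Finset.mem_filter, Finset.mem_univ, true_and, Fin.le_def, Fin.lt_def]
      omega
  have hsplit : Finset.univ.filter (· ≤ i) = insert i (Finset.univ.filter (· < i)) := by
    ext j
    simp [le_iff_eq_or_lt]
  rw [gradedDim_top, hdim i, hprev, hsplit, Finset.sum_insert (by simp)]
  push_cast
  ring

lemma sum_gradedDim {F : Fin r → Submodule K (Fin n → K)} (hr : 0 < r)
    (htop : F ⟨r - 1, by omega⟩ = ⊤) (W : Submodule K (Fin n → K)) :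
    ∑ i, gradedDim F W i = Module.finrank K W := by
  let g : ℕ → ℚ := fun j => if h : j - 1 < r ∧ j ≠ 0 then
    Module.finrank K ↥(F ⟨j - 1, h.1⟩ ⊓ W) else 0
  have hterm : ∀ i : Fin r, gradedDim F W i = g (i + 1) - g i := by
    intro i
    have hi := i.isLt
    have hi' : (i : ℕ) - 1 < r := by omega
    by_cases h : (i : ℕ) = 0
    · obtain rfl : i = ⟨0, hr⟩ := Fin.ext h
      rw [gradedDim_zero]
      simp [g, hr]
    · rw [gradedDim, flagPrev_of_ne_zero F h]
      simp [g, h, hi']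
  rw [Finset.sum_congr rfl fun i _ => hterm i,
    Fin.sum_univ_eq_sum_range (fun j => g (j + 1) - g j) r, Finset.sum_range_sub]
  have hgr : g r = Module.finrank K ↥(F ⟨r - 1, by omega⟩ ⊓ W) := dif_pos ⟨by omega, hr.ne'⟩
  rw [hgr, htop, top_inf_eq]
  simp [g]

end Flag

/-- In the flag setup with `m₁ = 1` and `y₂ < 0`, a flag of type `(y, m)`
is semistable iff its line `F₁` is not contained in `k̄ ⊗ H` for any `k`-rational
hyperplane `H ⊆ V = k^n`. -/
theorem stmt10 (k K : Type*) [Field k] [Finite k] [Field K] [Algebra k K]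
    [IsAlgClosure k K]
    (n r : ℕ) (hn : 2 ≤ n) (hr : 2 ≤ r)
    (y : Fin r → ℚ) (hy : ∀ i j : Fin r, i < j → y j < y i)
    (m : Fin r → ℕ) (hm : ∀ i, 1 ≤ m i) (hmsum : ∑ i, m i = n)
    (hwsum : ∑ i, (m i : ℚ) * y i = 0)
    (hm1 : m ⟨0, by omega⟩ = 1) (hy2 : y ⟨1, by omega⟩ < 0)
    (F : Fin r → Submodule K (Fin n → K)) (hmono : StrictMono F)
    (hdim : ∀ i : Fin r,
      Module.finrank K ↥(F i) = ∑ j ∈ Finset.univ.filter (· ≤ i), m j)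
    (htop : F ⟨r - 1, by omega⟩ = ⊤) :
    IsSemistableFlag k K n r y F ↔
      ∀ H : Submodule k (Fin n → k), Module.finrank k ↥H = n - 1 →
        ¬ (F ⟨0, by omega⟩ ≤ baseChange k K n H) := by
  have hr0 : 0 < r := by omega
  have hF := hmono.monotone
  have hm' := gradedDim_top_eq hdim
  have hneg : ∀ i : Fin r, i ≠ ⟨0, hr0⟩ → y i < 0 := by
    intro i hi
    have hi0 : (i : ℕ) ≠ 0 := fun h => hi (Fin.ext h)
    rcases eq_or_ne i ⟨1, by omega⟩ with rfl | h1
    · exact hy2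
    · have hi1 : (i : ℕ) ≠ 1 := fun h => h1 (Fin.ext h)
      exact (hy _ i (Fin.lt_def.2 (by simp only; omega))).trans hy2
  have hdeg : ∀ U, degFlag k K n r y F U =
      ∑ i, y i * gradedDim F (baseChange k K n U) i := fun _ => rfl
  have hF0 : Module.finrank K (F ⟨0, hr0⟩) = 1 := by
    have h := hm' ⟨0, hr0⟩
    rw [gradedDim_zero, inf_top_eq, hm1] at h
    exact_mod_cast h
  have hwsum' : ∑ i, y i * gradedDim F ⊤ i = 0 := by
    rw [← hwsum]
    exact Finset.sum_congr rfl fun i _ => by rw [hm', mul_comm]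
  constructor
  · intro hss H hH hle
    have hHbot : H ≠ ⊥ := by
      rintro rfl
      rw [finrank_bot] at hH
      omega
    have hdegH := hss H hHbot
    set W := baseChange k K n H
    have hWdim : (Module.finrank K W : ℚ) < n := by
      have : Module.finrank K W ≤ Module.finrank k H := finrank_baseChange_le H
      exact_mod_cast (show Module.finrank K W < n by omega)
    have hsum : ∑ i, gradedDim F W i < ∑ i, gradedDim F ⊤ i := by
      rw [sum_gradedDim hr0 htop, sum_gradedDim hr0 htop, finrank_top, Module.finrank_fin_fun]
      exact hWdim
    obtain ⟨i, -, hi⟩ := Finset.exists_lt_of_sum_lt hsum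
    have hzero : gradedDim F W ⟨0, hr0⟩ = gradedDim F ⊤ ⟨0, hr0⟩ := by
      rw [gradedDim_zero, gradedDim_zero, inf_eq_left.2 hle, inf_top_eq]
    have hi0 : i ≠ ⟨0, hr0⟩ := by
      rintro rfl
      exact hi.ne hzero
    have hlt : ∑ i, y i * gradedDim F ⊤ i < ∑ i, y i * gradedDim F W i := by
      refine Finset.sum_lt_sum (fun j _ => ?_)
        ⟨i, Finset.mem_univ i, mul_lt_mul_of_neg_left hi (hneg i hi0)⟩
      by_cases hj : j = ⟨0, hr0⟩
      · rw [hj, hzero]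
      · exact mul_le_mul_of_nonpos_left (gradedDim_le_gradedDim_top hF W j) (hneg j hj).le
    rw [hdeg] at hdegH
    linarith
  · intro hH U _
    rw [hdeg]
    by_cases hU : U = ⊤
    · rw [hU, baseChange_top, hwsum']
    obtain ⟨H, hUH, hHdim⟩ := exists_le_finrank_eq_of_ne_top hU
    have hnle : ¬ F ⟨0, hr0⟩ ≤ baseChange k K n U :=
      fun h => hH H hHdim (h.trans (baseChange_mono hUH))
    have hzero : gradedDim F (baseChange k K n U) ⟨0, hr0⟩ = 0 := by
      have hlt : Module.finrank K ↥(F ⟨0, hr0⟩ ⊓ baseChange k K n U) <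
          Module.finrank K (F ⟨0, hr0⟩) :=
        Submodule.finrank_lt_finrank_of_lt (inf_lt_left.2 hnle)
      rw [gradedDim_zero, Nat.cast_eq_zero]
      omega
    refine Finset.sum_nonpos fun i _ => ?_
    by_cases hi : i = ⟨0, hr0⟩
    · rw [hi, hzero, mul_zero]
    · exact mul_nonpos_of_nonpos_of_nonneg (hneg i hi).le (gradedDim_nonneg hF _ i)
end

section
/- Let ℓ ≥ 3 and t ≥ 1 be integers and let ν_1, …, ν_t ∈ (ℚ^{ℓ+1})^0_+, with ν_p = (x^{[p]}_1, …, x^{[p]}_{ℓ+1}). Then for every integer k with 2 ≤ k ≤ ℓ−1 and every index j ∈ {1,…,t}, one has Σ_{p=1}^t (x^{[p]}_{k+1} + x^{[p]}_{k+2} + ⋯ + x^{[p]}_{ℓ+1}) ≤ x^{[j]}_{k+1} − x^{[j]}_k. (This expresses that, for the Weil restriction Res_{k'/k} PGL_{ℓ+1} with [k':k] = t, the inequality (ω_i, s_β w_0 ν) > 0 fails for every middle index 1 < i < ℓ and every simple root β = α_i^{[j]} in Ψ(α_i).) -/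
/-- For a weakly decreasing rational tuple with vanishing sum, the sum of the entries from a middle
position `k` on is nonpositive and at most the gap between the entries at `k` and `k - 1`. -/
theorem sum_tail_le_of_antitone_of_sum_eq_zero {n k : ℕ} {x : Fin n → ℚ} (hx : Antitone x)
    (hsum : ∑ i, x i = 0) (hk : 2 ≤ k) (hkn : k + 2 ≤ n) :
    (∑ i with k ≤ (i : Fin n).val, x i) ≤ 0 ∧
      (∑ i with k ≤ (i : Fin n).val, x i) ≤ x ⟨k, by omega⟩ - x ⟨k - 1, by omega⟩ := by
  have hsplit := Finset.sum_filter_add_sum_filter_not Finset.univ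
    (fun i : Fin n => k ≤ (i : ℕ)) x
  have hcard := Finset.card_filter_add_card_filter_not (s := Finset.univ)
    (fun i : Fin n => k ≤ (i : ℕ))
  have hhead_card : (Finset.univ.filter fun i : Fin n => ¬ k ≤ (i : ℕ)).card = k := by
    simp only [not_le, Fin.card_filter_val_lt]
    omega
  have htail := Finset.sum_le_card_nsmul (Finset.univ.filter fun i : Fin n => k ≤ (i : ℕ)) x
    (x ⟨k, by omega⟩) fun i hi => hx (Fin.le_def.2 (Finset.mem_filter.1 hi).2)
  have hhead := Finset.card_nsmul_le_sum (Finset.univ.filter fun i : Fin n => ¬ k ≤ (i : ℕ)) x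
    (x ⟨k - 1, by omega⟩) fun i hi =>
      hx (Fin.le_def.2 (Nat.le_sub_one_of_lt (not_le.1 (Finset.mem_filter.1 hi).2)))
  have htail_card : 2 ≤ (Finset.univ.filter fun i : Fin n => k ≤ (i : ℕ)).card := by
    rw [Finset.card_univ, Fintype.card_fin] at hcard
    omega
  have hgap : x ⟨k, by omega⟩ ≤ x ⟨k - 1, by omega⟩ := hx (Fin.le_def.2 (Nat.sub_le k 1))
  rw [hhead_card, nsmul_eq_mul] at hhead
  rw [nsmul_eq_mul] at htail
  rw [hsum] at hsplit
  have htail_card' : (2 : ℚ) ≤ (Finset.univ.filter fun i : Fin n => k ≤ (i : ℕ)).card := by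
    exact_mod_cast htail_card
  have hk' : (2 : ℚ) ≤ k := by exact_mod_cast hk
  rcases le_total 0 (x ⟨k - 1, by omega⟩) with hb | hb
  · have hhead_two := mul_le_mul_of_nonneg_right hk' hb
    rcases le_total 0 (x ⟨k, by omega⟩) with ha | ha
    · constructor <;> linarith
    · have htail_two := mul_le_mul_of_nonpos_right htail_card' ha
      constructor <;> linarith
  · have htail_two := mul_le_mul_of_nonpos_right htail_card' (hgap.trans hb)
    constructor <;> linarith

/-- For `ν₁, …, ν_t ∈ (ℚ^{ℓ+1})^0_+` with `ℓ ≥ 3`, every middle index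
`2 ≤ k ≤ ℓ - 1` and every `j ∈ {1,…,t}`, one has
`∑_{p=1}^t (x^{[p]}_{k+1} + ⋯ + x^{[p]}_{ℓ+1}) ≤ x^{[j]}_{k+1} - x^{[j]}_k`
(1-based indexing; 0-based: positions `k, …, ℓ`). -/
theorem stmt12 (ℓ t : ℕ) (hl : 3 ≤ ℓ) (ht : 1 ≤ t)
    (ν : Fin t → Fin (ℓ + 1) → ℚ)
    (hmono : ∀ p : Fin t, ∀ i j : Fin (ℓ + 1), i ≤ j → ν p j ≤ ν p i)
    (hsum : ∀ p : Fin t, ∑ i, ν p i = 0)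
    (k : ℕ) (hk2 : 2 ≤ k) (hk : k + 1 ≤ ℓ) (j : Fin t) :
    (∑ p : Fin t, ∑ i ∈ Finset.univ.filter (fun i : Fin (ℓ + 1) => k ≤ (i : ℕ)), ν p i) ≤
      ν j ⟨k, by omega⟩ - ν j ⟨k - 1, by omega⟩ := by
  have htail (p : Fin t) := sum_tail_le_of_antitone_of_sum_eq_zero
    (fun i i' h => hmono p i i' h) (hsum p) hk2 (Nat.succ_le_succ hk)
  rw [← Finset.add_sum_erase _ _ (Finset.mem_univ j)]
  exact (add_le_of_nonpos_right (Finset.sum_nonpos fun p _ => (htail p).1)).trans (htail j).2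
end

section
/- Let ℓ ≥ 1 and t ≥ 1 be integers and let ν_1, …, ν_t ∈ (ℚ^{ℓ+1})^0_+, with ν_p = (x^{[p]}_1, …, x^{[p]}_{ℓ+1}). Then the following are equivalent: (1) there exist an integer k with 1 ≤ k ≤ ℓ and an index j ∈ {1,…,t} such that Σ_{p=1}^t (x^{[p]}_{ℓ−k+2} + ⋯ + x^{[p]}_{ℓ+1}) > x^{[j]}_{ℓ−k+2} − x^{[j]}_{ℓ−k+1}; (2) there exists a unique index j ∈ {1,…,t} such that Σ_{i ≠ j} x^{[i]}_{ℓ+1} > −x^{[j]}_ℓ or Σ_{i ≠ j} x^{[i]}_1 < −x^{[j]}_2. (This is the combinatorial core of the determination of when the period domain for the k-simple adjoint group Res_{k'/k} PGL_{ℓ+1}, [k':k] = t, has a codimension-one complement, and hence a nontrivial fundamental group.) -/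
section AntitoneSumZero

open Finset

variable {ℓ : ℕ} {x : Fin (ℓ + 1) → ℚ}

theorem sum_tail_eq_neg_sum_head (h0 : ∑ i, x i = 0) (m : ℕ) :
    ∑ i with m ≤ Fin.val (n := ℓ + 1) i, x i = -∑ i with ¬ m ≤ Fin.val (n := ℓ + 1) i, x i := by
  have := sum_filter_add_sum_filter_not univ (fun i : Fin (ℓ + 1) => m ≤ (i : ℕ)) x
  linarith

theorem sum_tail_last (x : Fin (ℓ + 1) → ℚ) :
    ∑ i with ℓ ≤ Fin.val (n := ℓ + 1) i, x i = x (Fin.last ℓ) := by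
  have : univ.filter (fun i : Fin (ℓ + 1) => ℓ ≤ (i : ℕ)) = {Fin.last ℓ} := by
    ext i
    simp only [mem_filter, mem_univ, true_and, mem_singleton, Fin.ext_iff, Fin.val_last]
    omega
  rw [this, sum_singleton]

theorem sum_tail_one (h0 : ∑ i, x i = 0) : ∑ i with 1 ≤ Fin.val (n := ℓ + 1) i, x i = -x 0 := by
  have : univ.filter (fun i : Fin (ℓ + 1) => ¬ 1 ≤ (i : ℕ)) = {0} := by
    ext i
    simp only [mem_filter, mem_univ, true_and, mem_singleton, Fin.ext_iff, Fin.val_zero]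
    omega
  rw [sum_tail_eq_neg_sum_head h0, this, sum_singleton]

theorem Antitone.sum_tail_nonpos (hx : Antitone x) (h0 : ∑ i, x i = 0) (m : ℕ) :
    ∑ i with m ≤ Fin.val (n := ℓ + 1) i, x i ≤ 0 := by
  by_cases hm : ∀ i : Fin (ℓ + 1), m ≤ (i : ℕ) → x i ≤ 0
  · exact sum_nonpos fun i hi => hm i (mem_filter.1 hi).2
  · push Not at hm
    obtain ⟨a, ha, hxa⟩ := hm
    rw [sum_tail_eq_neg_sum_head h0, neg_nonpos]
    refine sum_nonneg fun i hi => hxa.le.trans (hx ?_)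
    have := (mem_filter.1 hi).2
    exact Fin.le_def.2 (by omega)

theorem Antitone.apply_last_nonpos (hx : Antitone x) (h0 : ∑ i, x i = 0) :
    x (Fin.last ℓ) ≤ 0 :=
  sum_tail_last x ▸ hx.sum_tail_nonpos h0 ℓ

theorem Antitone.apply_zero_nonneg (hx : Antitone x) (h0 : ∑ i, x i = 0) : 0 ≤ x 0 := by
  have := hx.sum_tail_nonpos h0 1
  rw [sum_tail_one h0] at this
  linarith

theorem Antitone.add_last_nonpos (hx : Antitone x) (h0 : ∑ i, x i = 0) {a : Fin (ℓ + 1)}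
    (ha : (a : ℕ) + 1 = ℓ) (hxa : 0 ≤ x a) : x a + x (Fin.last ℓ) ≤ 0 := by
  have hhead := sum_tail_eq_neg_sum_head h0 ℓ
  rw [sum_tail_last] at hhead
  have : x a ≤ ∑ i with ¬ ℓ ≤ Fin.val (n := ℓ + 1) i, x i := by
    refine single_le_sum (f := x) (fun i hi => hxa.trans (hx ?_)) (by simp; omega)
    have := (mem_filter.1 hi).2
    exact Fin.le_def.2 (by omega)
  linarith

theorem Antitone.add_zero_nonneg (hx : Antitone x) (h0 : ∑ i, x i = 0) {b : Fin (ℓ + 1)}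
    (hb : (b : ℕ) = 1) (hxb : x b ≤ 0) : 0 ≤ x 0 + x b := by
  have htail := sum_tail_one h0
  have hneg : ∀ i ∈ univ.filter (fun i : Fin (ℓ + 1) => 1 ≤ (i : ℕ)), 0 ≤ -x i := by
    intro i hi
    have := (mem_filter.1 hi).2
    have := hx (Fin.le_def.2 (by omega) : b ≤ i)
    linarith
  have := single_le_sum (f := fun i => -x i) hneg (a := b) (by simp [hb])
  rw [sum_neg_distrib] at this
  linarith

/-- A tail sum strictly above the jump `x b - x a` across the cut can only occur when the cut
isolates the first or the last coordinate. -/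
theorem Antitone.cut_eq_one_or_last (hx : Antitone x) (h0 : ∑ i, x i = 0)
    {m : ℕ} {a b : Fin (ℓ + 1)} (ha : (a : ℕ) + 1 = m) (hb : (b : ℕ) = m)
    (h : x b - x a < ∑ i with m ≤ Fin.val (n := ℓ + 1) i, x i) : m = 1 ∨ m = ℓ := by
  by_contra! hm
  have hbℓ := b.isLt
  have hhead := sum_tail_eq_neg_sum_head h0 m
  have hbl : b ≠ Fin.last ℓ := fun e => by simp [e] at hb; omega
  have ha0 : 0 ≠ a := fun e => by simp [← e] at ha; omega
  have htail_le : x b ≤ 0 → ∑ i with m ≤ Fin.val (n := ℓ + 1) i, x i ≤ x b + x (Fin.last ℓ) := by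
    intro hxb
    rw [← sum_pair hbl, ← neg_le_neg_iff, ← sum_neg_distrib, ← sum_neg_distrib]
    refine sum_le_sum_of_subset_of_nonneg ?_ fun i hi _ => ?_
    · intro i hi
      simp only [mem_insert, mem_singleton] at hi
      rcases hi with rfl | rfl <;> simp <;> omega
    · have := (mem_filter.1 hi).2
      have := hx (Fin.le_def.2 (by omega) : b ≤ i)
      linarith
  have hhead_ge : 0 ≤ x a → x 0 + x a ≤ ∑ i with ¬ m ≤ Fin.val (n := ℓ + 1) i, x i := by
    intro hxa
    rw [← sum_pair ha0]
    refine sum_le_sum_of_subset_of_nonneg ?_ fun i hi _ => ?_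
    · intro i hi
      simp only [mem_insert, mem_singleton] at hi
      rcases hi with rfl | rfl <;> simp <;> omega
    · have := (mem_filter.1 hi).2
      exact hxa.trans (hx (Fin.le_def.2 (by omega)))
  have hab : x b ≤ x a := hx (Fin.le_def.2 (by omega))
  have h0a : x a ≤ x 0 := hx (Fin.zero_le a)
  have hbl' : x (Fin.last ℓ) ≤ x b := hx (Fin.le_last b)
  rcases le_total (x a) 0 with hxa | hxa
  · have := htail_le (hab.trans hxa)
    linarith
  · have := hhead_ge hxa
    rcases le_total (x b) 0 with hxb | hxb
    · have := htail_le hxb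
      linarith
    · linarith

end AntitoneSumZero

/-- For `ν₁, …, ν_t ∈ (ℚ^{ℓ+1})^0_+` (the case `Res_{k'/k} PGL_{ℓ+1}`),
the following are equivalent:
(1) there exist `1 ≤ k ≤ ℓ` and `j ∈ {1,…,t}` with
`∑_{p=1}^t (x^{[p]}_{ℓ-k+2} + ⋯ + x^{[p]}_{ℓ+1}) > x^{[j]}_{ℓ-k+2} - x^{[j]}_{ℓ-k+1}`;
(2) there is a unique `j` with `∑_{i ≠ j} x^{[i]}_{ℓ+1} > -x^{[j]}_ℓ` or
`∑_{i ≠ j} x^{[i]}_1 < -x^{[j]}_2`. -/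
theorem stmt15 (ℓ t : ℕ) (hl : 1 ≤ ℓ) (ht : 1 ≤ t)
    (ν : Fin t → Fin (ℓ + 1) → ℚ)
    (hmono : ∀ p : Fin t, ∀ i j : Fin (ℓ + 1), i ≤ j → ν p j ≤ ν p i)
    (hsum : ∀ p : Fin t, ∑ i, ν p i = 0) :
    (∃ (k : ℕ) (h1 : 1 ≤ k) (h2 : k ≤ ℓ) (j : Fin t),
        (∑ p : Fin t,
            ∑ i ∈ Finset.univ.filter (fun i : Fin (ℓ + 1) => ℓ - k + 1 ≤ (i : ℕ)), ν p i) >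
          ν j ⟨ℓ - k + 1, by omega⟩ - ν j ⟨ℓ - k, by omega⟩) ↔
      (∃! j : Fin t,
        (∑ i ∈ Finset.univ.filter (· ≠ j), ν i (Fin.last ℓ)) > -(ν j ⟨ℓ - 1, by omega⟩) ∨
          (∑ i ∈ Finset.univ.filter (· ≠ j), ν i 0) < -(ν j ⟨1, by omega⟩)) := by
  classical
  have hanti : ∀ p, Antitone (ν p) := fun p i j hij => hmono p i j hij
  have herase : ∀ (f : Fin t → ℚ) (j : Fin t),
      ∑ i ∈ Finset.univ.filter (· ≠ j), f i = (∑ i, f i) - f j := fun f j => by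
    rw [Finset.filter_ne', ← Finset.add_sum_erase _ f (Finset.mem_univ j), add_sub_cancel_left]
  have hlast : ∀ p, ν p (Fin.last ℓ) ≤ 0 := fun p => (hanti p).apply_last_nonpos (hsum p)
  have hzero : ∀ p, 0 ≤ ν p 0 := fun p => (hanti p).apply_zero_nonneg (hsum p)
  constructor
  · rintro ⟨k, h1, h2, j, h⟩
    refine existsUnique_of_exists_of_unique ⟨j, ?_⟩ ?_
    · have hj : ν j ⟨ℓ - k + 1, by omega⟩ - ν j ⟨ℓ - k, by omega⟩ <
          ∑ i ∈ Finset.univ.filter (fun i : Fin (ℓ + 1) => ℓ - k + 1 ≤ (i : ℕ)), ν j i := by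
        refine lt_of_lt_of_le h ?_
        rw [← Finset.add_sum_erase _ _ (Finset.mem_univ j)]
        have := Finset.sum_nonpos fun p (_ : p ∈ Finset.univ.erase j) =>
          (hanti p).sum_tail_nonpos (hsum p) (ℓ - k + 1)
        linarith
      rw [herase, herase]
      rcases (hanti j).cut_eq_one_or_last (hsum j) (m := ℓ - k + 1) rfl rfl hj with hm | hm
      · right
        obtain rfl : k = ℓ := by omega
        simp only [Nat.sub_self, zero_add, sum_tail_one (hsum _), Finset.sum_neg_distrib,
          Fin.zero_eta] at h
        linarith
      · left
        obtain rfl : k = 1 := by omega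
        simp only [Nat.sub_add_cancel hl, sum_tail_last] at h
        change _ > ν j (Fin.last ℓ) - _ at h
        linarith
    · intro a b ha hb
      by_contra hab
      have hL : ∀ a b : Fin t, a ≠ b →
          (∑ i ∈ Finset.univ.filter (· ≠ a), ν i (Fin.last ℓ)) ≤ ν b (Fin.last ℓ) := by
        intro a b hab
        have := Finset.single_le_sum (f := fun i => -ν i (Fin.last ℓ))
          (s := Finset.univ.filter (· ≠ a)) (fun i _ => neg_nonneg.2 (hlast i)) (a := b)
          (by simp [hab.symm])
        rw [Finset.sum_neg_distrib] at this
        linarith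
      have hZ : ∀ a b : Fin t, a ≠ b →
          ν b 0 ≤ ∑ i ∈ Finset.univ.filter (· ≠ a), ν i 0 := fun a b hab =>
        Finset.single_le_sum (f := fun i => ν i 0) (fun i _ => hzero i) (by simp [hab.symm])
      have hle1 : ∀ p, ν p (Fin.last ℓ) ≤ ν p ⟨1, by omega⟩ := fun p => hanti p (Fin.le_last _)
      have hge1 : ∀ p, ν p ⟨ℓ - 1, by omega⟩ ≤ ν p 0 := fun p => hanti p (Fin.zero_le _)
      have hA : ∀ p, 0 ≤ ν p ⟨ℓ - 1, by omega⟩ →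
          ν p ⟨ℓ - 1, by omega⟩ + ν p (Fin.last ℓ) ≤ 0 := fun p hp =>
        (hanti p).add_last_nonpos (hsum p) (Nat.sub_add_cancel hl) hp
      have hB : ∀ p, ν p ⟨1, by omega⟩ ≤ 0 → 0 ≤ ν p 0 + ν p ⟨1, by omega⟩ := fun p hp =>
        (hanti p).add_zero_nonneg (hsum p) rfl hp
      have hLab := hL a b hab
      have hLba := hL b a (Ne.symm hab)
      have hZab := hZ a b hab
      have hZba := hZ b a (Ne.symm hab)
      rcases ha with ha | ha <;> rcases hb with hb | hb
      · linarith [hA a (by linarith [hlast b]), hA b (by linarith [hlast a])]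
      · linarith [hge1 a, hle1 b]
      · linarith [hge1 b, hle1 a]
      · linarith [hB a (by linarith [hzero b]), hB b (by linarith [hzero a])]
  · rintro ⟨j, hj, -⟩
    simp only [herase] at hj
    rcases hj with hj | hj
    · refine ⟨1, le_rfl, hl, j, ?_⟩
      simp only [Nat.sub_add_cancel hl, sum_tail_last]
      change _ > ν j (Fin.last ℓ) - _
      linarith
    · refine ⟨ℓ, hl, le_rfl, j, ?_⟩
      simp only [Nat.sub_self, zero_add, sum_tail_one (hsum _), Finset.sum_neg_distrib,
        Fin.zero_eta]
      linarith
end
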